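/- Let λ, d > 0, P(x, S) = 2dλ − x³ + xS, S* the unique positive solution of P(x, x) = 0, R = {(x, S) ∈ ℝ²_{≥0} : S ≤ x, P(x, S) ≥ 0}, and suppose η < min{2/(3(S*+1)²), 2/max_{(x,S)∈R} P(x, S)}. With x_0 = S_0 = 0, x_{t+1} = x_t + (η/2) P(x_t, S_t), S_{t+1} = S_t + (η²/4) P(x_t, S_t)², and S_∞ = lim_t S_t, the limit ℓ_{S_∞} of (x_t) satisfies ℓ_{S_∞} ≤ S*. -/

import Mathlib

/-- Under the step-size bound, the limit `ℓ_{S_∞}` of `(x_t)` satisfies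
`ℓ_{S_∞} ≤ S*`, where `S_∞ = lim_t S_t`. -/
theorem stmt_14 (lam d η : ℝ) (hlam : 0 < lam) (hd : 0 < d) (hη : 0 < η)
    (Sstar : ℝ) (hSstar : 0 < Sstar)
    (hSstarroot : 2 * d * lam - Sstar ^ 3 + Sstar * Sstar = 0)
    (hSstaruniq : ∀ z, 0 < z → 2 * d * lam - z ^ 3 + z * z = 0 → z = Sstar)
    (Pmax : ℝ)
    (hPmax : IsGreatest ((fun p : ℝ × ℝ => 2 * d * lam - p.1 ^ 3 + p.1 * p.2) ''
      {p : ℝ × ℝ | 0 ≤ p.1 ∧ 0 ≤ p.2 ∧ p.2 ≤ p.1 ∧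
        0 ≤ 2 * d * lam - p.1 ^ 3 + p.1 * p.2}) Pmax)
    (hηbound : η < min (2 / (3 * (Sstar + 1) ^ 2)) (2 / Pmax))
    (ℓ : ℝ → ℝ)
    (hℓpos : ∀ s, 0 ≤ s → 0 < ℓ s)
    (hℓroot : ∀ s, 0 ≤ s → 2 * d * lam - (ℓ s) ^ 3 + ℓ s * s = 0)
    (hℓuniq : ∀ s, 0 ≤ s → ∀ z, 0 < z → 2 * d * lam - z ^ 3 + z * s = 0 → z = ℓ s)
    (x S : ℕ → ℝ) (hx0 : x 0 = 0) (hS0 : S 0 = 0)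
    (hx : ∀ t, x (t + 1) = x t + (η / 2) * (2 * d * lam - (x t) ^ 3 + x t * S t))
    (hS : ∀ t, S (t + 1) = S t + (η ^ 2 / 4) * (2 * d * lam - (x t) ^ 3 + x t * S t) ^ 2)
    (Sinf : ℝ) (hSinf : Filter.Tendsto S Filter.atTop (nhds Sinf)) :
    ℓ Sinf ≤ Sstar := by
  have hc : 0 < 2 * d * lam := by positivity
  generalize 2 * d * lam = c at *
  have hS1 : 1 < Sstar := by
    by_contra h
    push Not at h
    nlinarith [mul_nonneg (sq_nonneg Sstar) (sub_nonneg.2 h)]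
  have hP0 : 0 < Pmax := by
    have : c ≤ Pmax := hPmax.2 ⟨(0, 0), by simp [hc.le], by simp⟩
    linarith
  have h1 : η * (3 * (Sstar + 1) ^ 2) < 2 := by
    have := lt_of_lt_of_le hηbound (min_le_left _ _)
    rwa [lt_div_iff₀ (by positivity)] at this
  have h2 : η * Pmax < 2 := by
    have := lt_of_lt_of_le hηbound (min_le_right _ _)
    rwa [lt_div_iff₀ hP0] at this
  have hxle : ∀ a b : ℝ, 0 ≤ a → b ≤ a → 0 ≤ c - a ^ 3 + a * b → a ≤ Sstar := by
    intro a b ha hb hp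
    by_contra h
    push Not at h
    have e1 : a * b ≤ a * a := mul_le_mul_of_nonneg_left hb ha
    have e2 : Sstar * Sstar * (Sstar - 1) < a * a * (a - 1) := by
      apply mul_lt_mul'' (mul_self_lt_mul_self hSstar.le h) (by linarith) (by positivity) (by linarith)
    nlinarith
  have inv : ∀ t, 0 ≤ x t ∧ 0 ≤ S t ∧ S t ≤ x t ∧ 0 ≤ c - x t ^ 3 + x t * S t := by
    intro t
    induction t with
    | zero => simp [hx0, hS0, hc.le]
    | succ t ih =>
      obtain ⟨i1, i2, i3, i4⟩ := ih
      have hle : c - x t ^ 3 + x t * S t ≤ Pmax :=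
        hPmax.2 ⟨(x t, S t), ⟨i1, i2, i3, i4⟩, rfl⟩
      have hxs := hxle _ _ i1 i3 i4
      rw [hx, hS]
      generalize x t = a at *
      generalize S t = b at *
      obtain ⟨p, hp⟩ : ∃ p, p = c - a ^ 3 + a * b := ⟨_, rfl⟩
      rw [← hp] at i4 hle ⊢
      obtain ⟨δ, hδ⟩ : ∃ δ, δ = η / 2 * p := ⟨_, rfl⟩
      have hδ2 : η ^ 2 / 4 * p ^ 2 = δ ^ 2 := by rw [hδ]; ring
      rw [hδ2, ← hδ]
      have d0 : 0 ≤ δ := by rw [hδ]; positivity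
      have d1 : δ ≤ 1 := by
        have := mul_le_mul_of_nonneg_left hle hη.le
        rw [hδ]; linarith
      have d2 : δ * (3 * (Sstar + 1) ^ 2) ≤ p := by
        have := mul_le_mul_of_nonneg_left h1.le i4
        rw [hδ]; linarith
      have d3 : 3 * a ^ 2 + 3 * a * δ + δ ^ 2 ≤ 3 * (Sstar + 1) ^ 2 := by
        have : (a + δ) ^ 2 ≤ (Sstar + 1) ^ 2 := by gcongr
        nlinarith [mul_nonneg i1 d0]
      have d4 := mul_le_mul_of_nonneg_left d3 d0
      refine ⟨by positivity, by positivity, by nlinarith, ?_⟩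
      have d5 : 0 ≤ (a + δ) * δ ^ 2 := by positivity
      have d6 : 0 ≤ δ * b := by positivity
      nlinarith
  have s0 : 0 ≤ Sinf := ge_of_tendsto' hSinf fun t => (inv t).2.1
  have s1 : Sinf ≤ Sstar := le_of_tendsto' hSinf fun t =>
    (inv t).2.2.1.trans (hxle _ _ (inv t).1 (inv t).2.2.1 (inv t).2.2.2)
  have l0 := hℓpos _ s0
  have lr := hℓroot _ s0
  generalize ℓ Sinf = l at *
  by_contra h
  push Not at h
  have e1 : l * Sinf ≤ l * l := mul_le_mul_of_nonneg_left (by linarith) l0.le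
  exact absurd (hxle l Sinf l0.le (by linarith) lr.ge) (not_le.2 h)
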